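/- The probability that an A-served side-out game sequence produces score (α, β) with B scoring last equals p_a^α p_b^β (1-p_a) (1-q)^{-(α+β)} ∑_{r=1}^{min(α,β-1)+1} C(α,r-1) C(β-1,r-1) q^{r-1}, where q = (1-p_a)(1-p_b). -/

import Mathlib

open scoped BigOperators
open Filter

/-- Side-out scoring: a trajectory is the list of rally outcomes, `true` meaning that the
current server wins the rally.  `soScorers srv g` is the list of scorers (`true` = player A),
where `srv` is the current server. -/
def soScorers : Bool → List Bool → List Bool
  | _, [] => []
  | srv, s :: rest => (if s then [srv] else []) ++ soScorers (if s then srv else !srv) rest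

/-- Probability weight of a trajectory of rally outcomes: the server wins a rally with
probability `pa` (if A serves) or `pb` (if B serves); rallies are independent. -/
def soWeight (pa pb : ℝ) : Bool → List Bool → ℝ
  | _, [] => 1
  | srv, s :: rest =>
      (if srv then (if s then pa else 1 - pa) else (if s then pb else 1 - pb)) *
        soWeight pa pb (if s then srv else !srv) rest

/-- Points scored by player A (first server A). -/
def soScoreA (g : List Bool) : ℕ := (soScorers true g).count true

/-- Points scored by player B (first server A). -/
def soScoreB (g : List Bool) : ℕ := (soScorers true g).count false

/-- The trajectory ends with a rally in which A scores a point. -/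
def soLastA (g : List Bool) : Prop :=
  g.getLast? = some true ∧ (soScorers true g).getLast? = some true

/-- The trajectory ends with a rally in which B scores a point. -/
def soLastB (g : List Bool) : Prop :=
  g.getLast? = some true ∧ (soScorers true g).getLast? = some false

/-- Number of maximal runs of `false` in a list, the first argument being the previous value. -/
def falseRuns : Bool → List Bool → ℕ
  | _, [] => 0
  | prev, b :: rest => (if prev && !b then 1 else 0) + falseRuns b rest

/-- Number of A-interruptions: maximal stretches in which B gains the serve from A and
scores at least one point, i.e. maximal blocks of points scored by B. -/
def soInter (g : List Bool) : ℕ := falseRuns true (soScorers true g)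

/-- Number of exchanges: pairs of consecutive rallies in which a player gains the right to
serve and immediately loses it without scoring. -/
def exchCount : List Bool → ℕ
  | [] => 0
  | true :: rest => exchCount rest
  | [false] => 0
  | false :: true :: rest => exchCount rest
  | false :: false :: rest => 1 + exchCount rest

/-- Probability of a set of trajectories in the side-out model, first server A. -/
noncomputable def soPr (pa pb : ℝ) (E : Set (List Bool)) : ℝ :=
  ∑' g : List Bool, Set.indicator E (soWeight pa pb true) g

/-- Conditional expectation of `f` given the event `E` in the side-out model, first server A. -/
noncomputable def soCondExp (pa pb : ℝ) (E : Set (List Bool)) (f : List Bool → ℝ) : ℝ :=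
  (∑' g : List Bool, Set.indicator E (fun g => soWeight pa pb true g * f g) g) / soPr pa pb E

/-- Rally lists of length less than `n`. -/
def shortLists : ℕ → Finset (List Bool)
  | 0 => ∅
  | n + 1 => insert [] ((shortLists n).image (List.cons true) ∪ (shortLists n).image (List.cons false))

theorem mem_shortLists {n : ℕ} {g : List Bool} : g ∈ shortLists n ↔ g.length < n := by
  induction n generalizing g with
  | zero => simp [shortLists]
  | succ n ih =>
    rcases g with _ | ⟨_ | _, g⟩ <;> simp [shortLists, ih]

theorem sum_shortLists_succ (n : ℕ) (h : List Bool → ℝ) :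
    ∑ g ∈ shortLists (n + 1), h g =
      h [] + ∑ g ∈ shortLists n, h (true :: g) + ∑ g ∈ shortLists n, h (false :: g) := by
  rw [shortLists, Finset.sum_insert (by simp), Finset.sum_union, Finset.sum_image (by simp),
    Finset.sum_image (by simp), add_assoc]
  rw [Finset.disjoint_left]
  simp

theorem monotone_shortLists : Monotone shortLists := by
  intro m n hmn g
  simp only [mem_shortLists]
  omega

theorem tendsto_shortLists : Tendsto shortLists atTop atTop :=
  tendsto_atTop_finset_of_monotone monotone_shortLists
    fun g => ⟨g.length + 1, mem_shortLists.2 (Nat.lt_succ_self _)⟩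

theorem exists_subset_shortLists (u : Finset (List Bool)) : ∃ n, u ⊆ shortLists n :=
  (tendsto_shortLists.eventually (eventually_ge_atTop u)).exists

theorem soScorers_ne_nil {s : Bool} {g : List Bool} (h : g.getLast? = some true) :
    soScorers s g ≠ [] := by
  induction g generalizing s with
  | nil => simp at h
  | cons c g ih =>
    cases c
    · rcases g with _ | ⟨d, g⟩
      · simp at h
      · rw [List.getLast?_cons_cons] at h
        simpa [soScorers] using ih (s := !s) h
    · simp [soScorers]

theorem soWeight_nonneg {pa pb : ℝ} (hpa0 : 0 ≤ pa) (hpa1 : pa ≤ 1) (hpb0 : 0 ≤ pb)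
    (hpb1 : pb ≤ 1) (s : Bool) (g : List Bool) : 0 ≤ soWeight pa pb s g := by
  induction g generalizing s with
  | nil => simp [soWeight]
  | cons c g ih =>
    refine mul_nonneg ?_ (ih _)
    split_ifs <;> linarith

open Classical in
/-- The weight of `g` when, starting with server `s`, it yields score `(a, b + 1)` with B scoring
in the last rally, and zero otherwise. -/
noncomputable def lastBWeight (pa pb : ℝ) (s : Bool) (a b : ℕ) (g : List Bool) : ℝ :=
  if (soScorers s g).count true = a ∧ (soScorers s g).count false = b + 1 ∧
      g.getLast? = some true ∧ (soScorers s g).getLast? = some false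
  then soWeight pa pb s g else 0

section Recursion

variable (pa pb : ℝ)

theorem lastBWeight_nil (s : Bool) (a b : ℕ) : lastBWeight pa pb s a b [] = 0 := by
  simp [lastBWeight]

theorem lastBWeight_A_zero_true (b : ℕ) (g : List Bool) :
    lastBWeight pa pb true 0 b (true :: g) = 0 := by
  simp [lastBWeight, soScorers]

theorem lastBWeight_A_succ_true (a b : ℕ) (g : List Bool) :
    lastBWeight pa pb true (a + 1) b (true :: g) = pa * lastBWeight pa pb true a b g := by
  rcases g with _ | ⟨c, g⟩
  · simp [lastBWeight, soScorers]
  · have h (l : List Bool) : (true :: l).getLast? = some false ↔ l.getLast? = some false := by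
      rcases l with _ | ⟨d, l⟩ <;> simp [List.getLast?_cons_cons]
    rw [lastBWeight, lastBWeight, List.getLast?_cons_cons, soScorers, soWeight]
    simp only [if_true, List.singleton_append, h]
    simp

theorem lastBWeight_A_false (a b : ℕ) (g : List Bool) :
    lastBWeight pa pb true a b (false :: g) = (1 - pa) * lastBWeight pa pb false a b g := by
  rcases g with _ | ⟨c, g⟩
  · simp [lastBWeight]
  · rw [lastBWeight, lastBWeight, List.getLast?_cons_cons, soScorers, soWeight]
    simp

theorem lastBWeight_B_false (a b : ℕ) (g : List Bool) :
    lastBWeight pa pb false a b (false :: g) = (1 - pb) * lastBWeight pa pb true a b g := by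
  rcases g with _ | ⟨c, g⟩
  · simp [lastBWeight]
  · rw [lastBWeight, lastBWeight, List.getLast?_cons_cons, soScorers, soWeight]
    simp

theorem lastBWeight_B_succ_true (a b : ℕ) (g : List Bool) :
    lastBWeight pa pb false a (b + 1) (true :: g) = pb * lastBWeight pa pb false a b g := by
  rcases g with _ | ⟨c, g⟩
  · simp [lastBWeight, soScorers]
  · rw [lastBWeight, lastBWeight, List.getLast?_cons_cons, soScorers, soWeight]
    simp only [if_true, List.singleton_append]
    generalize soScorers false (c :: g) = l
    rcases l with _ | ⟨d, l⟩
    · simp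
    · simp [List.getLast?_cons_cons]

theorem lastBWeight_B_zero_true (a : ℕ) (g : List Bool) :
    lastBWeight pa pb false a 0 (true :: g) = if g = [] then (if a = 0 then pb else 0) else 0 := by
  rcases g with _ | ⟨c, g⟩
  · simp [lastBWeight, soScorers, soWeight, eq_comm]
  · rw [lastBWeight, if_neg, if_neg (by simp)]
    rintro ⟨-, h1, h2, h3⟩
    rw [List.getLast?_cons_cons] at h2
    have hne := soScorers_ne_nil (s := false) h2
    rw [soScorers] at h1 h3
    simp only [if_true, List.singleton_append] at h1 h3
    generalize soScorers false (c :: g) = l at *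
    rcases l with _ | ⟨d, l⟩
    · simp at hne
    · rw [List.getLast?_cons_cons] at h3
      have := List.count_pos_iff.2 (List.mem_of_getLast? h3)
      rw [List.count_cons_self] at h1
      omega

/-- The first-rally equations for the probabilities of score `(a, b + 1)` with B scoring last,
when A (`X true`) or B (`X false`) serves first. -/
structure FirstRallyEquations (X : Bool → ℕ → ℕ → ℝ) : Prop where
  A_zero (b : ℕ) : X true 0 b = (1 - pa) * X false 0 b
  A_succ (a b : ℕ) : X true (a + 1) b = pa * X true a b + (1 - pa) * X false (a + 1) b
  B_zero (a : ℕ) : X false a 0 = (if a = 0 then pb else 0) + (1 - pb) * X true a 0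
  B_succ (a b : ℕ) : X false a (b + 1) = pb * X false a b + (1 - pb) * X true a (b + 1)

variable {pa pb}

theorem FirstRallyEquations.unique (hq : (1 - pa) * (1 - pb) ≠ 1) {X Y : Bool → ℕ → ℕ → ℝ}
    (hX : FirstRallyEquations pa pb X) (hY : FirstRallyEquations pa pb Y) : X = Y := by
  have solve {x y u v c d : ℝ} (h1 : x = c + (1 - pa) * y) (h2 : y = d + (1 - pb) * x)
      (h3 : u = c + (1 - pa) * v) (h4 : v = d + (1 - pb) * u) : x = u ∧ y = v := by
    have h : (1 - (1 - pa) * (1 - pb)) * (x - u) = 0 := by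
      linear_combination h1 - h3 + (1 - pa) * (h2 - h4)
    have hxu : x = u :=
      sub_eq_zero.1 ((mul_eq_zero.1 h).resolve_left (sub_ne_zero.2 hq.symm))
    exact ⟨hxu, by rw [h2, h4, hxu]⟩
  have key (a b : ℕ) : X true a b = Y true a b ∧ X false a b = Y false a b := by
    induction a generalizing b with
    | zero =>
      induction b with
      | zero =>
        exact solve (c := 0) (by rw [zero_add]; exact hX.A_zero _) (hX.B_zero 0)
          (by rw [zero_add]; exact hY.A_zero _) (hY.B_zero 0)
      | succ b ih =>
        exact solve (c := 0) (by rw [zero_add]; exact hX.A_zero _) (hX.B_succ 0 b)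
          (by rw [zero_add]; exact hY.A_zero _) (by rw [ih.2]; exact hY.B_succ 0 b)
    | succ a iha =>
      induction b with
      | zero =>
        exact solve (hX.A_succ a _) (hX.B_zero _) (by rw [(iha 0).1]; exact hY.A_succ a _)
          (hY.B_zero _)
      | succ b ih =>
        exact solve (hX.A_succ a _) (hX.B_succ _ b)
          (by rw [(iha (b + 1)).1]; exact hY.A_succ a _) (by rw [ih.2]; exact hY.B_succ _ b)
  funext s a b
  cases s
  exacts [(key a b).2, (key a b).1]

variable (pa pb) in
/-- The part of the probability carried by rally lists of length less than `n`. -/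
noncomputable def lastBPartial (n : ℕ) (s : Bool) (a b : ℕ) : ℝ :=
  ∑ g ∈ shortLists n, lastBWeight pa pb s a b g

theorem lastBPartial_A_zero (n b : ℕ) :
    lastBPartial pa pb (n + 1) true 0 b = (1 - pa) * lastBPartial pa pb n false 0 b := by
  simp only [lastBPartial, sum_shortLists_succ, lastBWeight_nil, lastBWeight_A_zero_true,
    lastBWeight_A_false, Finset.mul_sum, Finset.sum_const_zero, zero_add]

theorem lastBPartial_A_succ (n a b : ℕ) :
    lastBPartial pa pb (n + 1) true (a + 1) b =
      pa * lastBPartial pa pb n true a b + (1 - pa) * lastBPartial pa pb n false (a + 1) b := by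
  simp only [lastBPartial, sum_shortLists_succ, lastBWeight_nil, lastBWeight_A_succ_true,
    lastBWeight_A_false, Finset.mul_sum, zero_add]

theorem lastBPartial_B_succ (n a b : ℕ) :
    lastBPartial pa pb (n + 1) false a (b + 1) =
      pb * lastBPartial pa pb n false a b + (1 - pb) * lastBPartial pa pb n true a (b + 1) := by
  simp only [lastBPartial, sum_shortLists_succ, lastBWeight_nil, lastBWeight_B_succ_true,
    lastBWeight_B_false, Finset.mul_sum, zero_add]

theorem lastBPartial_B_zero (n a : ℕ) :
    lastBPartial pa pb (n + 1) false a 0 =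
      (if 0 < n then (if a = 0 then pb else 0) else 0) +
        (1 - pb) * lastBPartial pa pb n true a 0 := by
  simp only [lastBPartial, sum_shortLists_succ, lastBWeight_nil, lastBWeight_B_zero_true,
    lastBWeight_B_false, Finset.mul_sum, zero_add, Finset.sum_ite_eq', mem_shortLists,
    List.length_nil]

theorem lastBPartial_le (hpa0 : 0 ≤ pa) (hpa1 : pa ≤ 1) (hpb0 : 0 ≤ pb) (hpb1 : pb ≤ 1)
    {X : Bool → ℕ → ℕ → ℝ} (hX : FirstRallyEquations pa pb X) (hX0 : ∀ s a b, 0 ≤ X s a b)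
    (n : ℕ) (s : Bool) (a b : ℕ) : lastBPartial pa pb n s a b ≤ X s a b := by
  have hqa : 0 ≤ 1 - pa := sub_nonneg.2 hpa1
  have hqb : 0 ≤ 1 - pb := sub_nonneg.2 hpb1
  induction n generalizing s a b with
  | zero => simpa [lastBPartial, shortLists] using hX0 s a b
  | succ n ih =>
    cases s
    · rcases b with _ | b
      · rw [lastBPartial_B_zero, hX.B_zero]
        refine add_le_add ?_ (mul_le_mul_of_nonneg_left (ih _ _ _) hqb)
        split_ifs <;> simp [hpb0]
      · rw [lastBPartial_B_succ, hX.B_succ]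
        exact add_le_add (mul_le_mul_of_nonneg_left (ih _ _ _) hpb0)
          (mul_le_mul_of_nonneg_left (ih _ _ _) hqb)
    · rcases a with _ | a
      · rw [lastBPartial_A_zero, hX.A_zero]
        exact mul_le_mul_of_nonneg_left (ih _ _ _) hqa
      · rw [lastBPartial_A_succ, hX.A_succ]
        exact add_le_add (mul_le_mul_of_nonneg_left (ih _ _ _) hpa0)
          (mul_le_mul_of_nonneg_left (ih _ _ _) hqa)

theorem FirstRallyEquations.of_tendsto {Y : Bool → ℕ → ℕ → ℝ}
    (hY : ∀ s a b, Tendsto (fun n => lastBPartial pa pb n s a b) atTop (nhds (Y s a b))) :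
    FirstRallyEquations pa pb Y where
  A_zero b := by
    refine tendsto_nhds_unique ((tendsto_add_atTop_iff_nat 1).2 (hY true 0 b)) ?_
    simp only [lastBPartial_A_zero]
    exact (hY _ _ _).const_mul _
  A_succ a b := by
    refine tendsto_nhds_unique ((tendsto_add_atTop_iff_nat 1).2 (hY true (a + 1) b)) ?_
    simp only [lastBPartial_A_succ]
    exact ((hY _ _ _).const_mul _).add ((hY _ _ _).const_mul _)
  B_zero a := by
    refine tendsto_nhds_unique ((tendsto_add_atTop_iff_nat 1).2 (hY false a 0)) ?_
    simp only [lastBPartial_B_zero]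
    refine Tendsto.add ?_ ((hY _ _ _).const_mul _)
    refine tendsto_const_nhds.congr' ?_
    filter_upwards [eventually_gt_atTop 0] with n hn
    rw [if_pos hn]
  B_succ a b := by
    refine tendsto_nhds_unique ((tendsto_add_atTop_iff_nat 1).2 (hY false a (b + 1))) ?_
    simp only [lastBPartial_B_succ]
    exact ((hY _ _ _).const_mul _).add ((hY _ _ _).const_mul _)

theorem tsum_lastBWeight (hpa0 : 0 ≤ pa) (hpa1 : pa ≤ 1) (hpb0 : 0 ≤ pb) (hpb1 : pb ≤ 1)
    (hq : (1 - pa) * (1 - pb) ≠ 1)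
    {X : Bool → ℕ → ℕ → ℝ} (hX : FirstRallyEquations pa pb X) (hX0 : ∀ s a b, 0 ≤ X s a b)
    (s : Bool) (a b : ℕ) : ∑' g, lastBWeight pa pb s a b g = X s a b := by
  have hnonneg (s : Bool) (a b : ℕ) (g : List Bool) : 0 ≤ lastBWeight pa pb s a b g := by
    rw [lastBWeight]
    split_ifs
    exacts [soWeight_nonneg hpa0 hpa1 hpb0 hpb1 s g, le_rfl]
  have hsum (s : Bool) (a b : ℕ) : Summable (lastBWeight pa pb s a b) := by
    refine summable_of_sum_le (c := X s a b) (hnonneg s a b) fun u => ?_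
    obtain ⟨n, hn⟩ := exists_subset_shortLists u
    exact (Finset.sum_le_sum_of_subset_of_nonneg hn fun g _ _ => hnonneg s a b g).trans
      (lastBPartial_le hpa0 hpa1 hpb0 hpb1 hX hX0 n s a b)
  have hlim : FirstRallyEquations pa pb fun s a b => ∑' g, lastBWeight pa pb s a b g :=
    .of_tendsto fun s a b => (hsum s a b).hasSum.comp tendsto_shortLists
  exact congrFun (congrFun (congrFun (hlim.unique hq hX) s) a) b

end Recursion

/-- The interruption polynomial when A serves first. -/
def interPolyA (q : ℝ) (a b : ℕ) : ℝ :=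
  ∑ k ∈ Finset.range (a + 1), (a.choose k : ℝ) * (b.choose k : ℝ) * q ^ k

/-- The interruption polynomial when B serves first. -/
def interPolyB (q : ℝ) : ℕ → ℕ → ℝ
  | 0, _ => 1
  | a + 1, b =>
      ∑ k ∈ Finset.range (a + 1), (a.choose k : ℝ) * ((b + 1).choose (k + 1) : ℝ) * q ^ (k + 1)

theorem sum_choose_succ (a : ℕ) (c : ℕ → ℝ) :
    ∑ k ∈ Finset.range (a + 2), ((a + 1).choose k : ℝ) * c k =
      ∑ k ∈ Finset.range (a + 1), (a.choose k : ℝ) * (c k + c (k + 1)) := by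
  rw [Finset.sum_range_succ']
  simp only [Nat.choose_succ_succ, Nat.cast_add, add_mul, mul_add, Finset.sum_add_distrib]
  have h : ∑ k ∈ Finset.range (a + 1), (a.choose (k + 1) : ℝ) * c (k + 1) + a.choose 0 * c 0 =
      ∑ k ∈ Finset.range (a + 1), (a.choose k : ℝ) * c k := by
    rw [← Finset.sum_range_succ' (fun k => (a.choose k : ℝ) * c k), Finset.sum_range_succ]
    simp
  simp only [Nat.choose_zero_right] at h ⊢
  linarith

theorem interPolyA_zero (q : ℝ) (b : ℕ) : interPolyA q 0 b = 1 := by simp [interPolyA]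

theorem interPolyA_zero_right (q : ℝ) (a : ℕ) : interPolyA q a 0 = 1 := by
  rw [interPolyA, Finset.sum_range_succ']
  simp

theorem interPolyB_zero_right (q : ℝ) (a : ℕ) : interPolyB q (a + 1) 0 = q := by
  rw [interPolyB, Finset.sum_range_succ']
  simp [Nat.choose_eq_zero_of_lt]

theorem interPolyA_succ (q : ℝ) (a b : ℕ) :
    interPolyA q (a + 1) b = (1 - q) * interPolyA q a b + interPolyB q (a + 1) b := by
  simp only [interPolyA, interPolyB, mul_assoc]
  rw [sum_choose_succ, Finset.mul_sum, ← Finset.sum_add_distrib]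
  refine Finset.sum_congr rfl fun k _ => ?_
  rw [Nat.choose_succ_succ]
  push_cast
  ring

theorem interPolyB_succ (q : ℝ) (a b : ℕ) :
    interPolyB q a (b + 1) = (1 - q) * interPolyB q a b + q * interPolyA q a (b + 1) := by
  rcases a with _ | a
  · simp [interPolyB, interPolyA_zero]
  · simp only [interPolyA, interPolyB, mul_assoc]
    rw [sum_choose_succ, Finset.mul_sum, Finset.mul_sum, ← Finset.sum_add_distrib]
    refine Finset.sum_congr rfl fun k _ => ?_
    rw [Nat.choose_succ_succ (b + 1) k]
    push_cast
    ring

theorem interPolyA_nonneg {q : ℝ} (hq : 0 ≤ q) (a b : ℕ) : 0 ≤ interPolyA q a b :=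
  Finset.sum_nonneg fun _ _ => by positivity

theorem interPolyB_nonneg {q : ℝ} (hq : 0 ≤ q) (a b : ℕ) : 0 ≤ interPolyB q a b := by
  rcases a with _ | a
  · exact zero_le_one
  · exact Finset.sum_nonneg fun _ _ => by positivity

theorem interPolyA_eq_sum_Icc (q : ℝ) (a b : ℕ) :
    interPolyA q a b = ∑ r ∈ Finset.Icc 1 (min a b + 1),
      (a.choose (r - 1) : ℝ) * (b.choose (r - 1) : ℝ) * q ^ (r - 1) := by
  rw [← Finset.Ico_add_one_right_eq_Icc, Finset.sum_Ico_eq_sum_range, interPolyA]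
  simp only [Nat.add_sub_cancel, Nat.add_sub_cancel_left]
  refine (Finset.sum_subset (Finset.range_mono (by omega)) fun k hk hk' => ?_).symm
  simp only [Finset.mem_range] at hk hk'
  rw [Nat.choose_eq_zero_of_lt (n := b) (by omega)]
  simp

/-- The closed form for the probability of score `(a, b + 1)` with B scoring last. -/
noncomputable def lastBProb (pa pb : ℝ) (s : Bool) (a b : ℕ) : ℝ :=
  pa ^ a * pb ^ (b + 1) / (1 - (1 - pa) * (1 - pb)) ^ (a + (b + 1)) *
    if s then (1 - pa) * interPolyA ((1 - pa) * (1 - pb)) a b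
    else interPolyB ((1 - pa) * (1 - pb)) a b

theorem firstRallyEquations_lastBProb {pa pb : ℝ} (hq : (1 - pa) * (1 - pb) ≠ 1) :
    FirstRallyEquations pa pb (lastBProb pa pb) := by
  have hd : 1 - (1 - pa) * (1 - pb) ≠ 0 := sub_ne_zero.2 hq.symm
  constructor
  · intro b
    simp only [lastBProb, interPolyA_zero, interPolyB, if_true, Bool.false_eq_true, if_false]
    ring
  · intro a b
    simp only [lastBProb, interPolyA_succ, if_true, Bool.false_eq_true, if_false]
    generalize hDe : 1 - (1 - pa) * (1 - pb) = D at *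
    rw [show a + 1 + (b + 1) = a + (b + 1) + 1 by ring]
    field_simp
    ring
  · intro a
    rcases a with _ | a
    · simp only [lastBProb, interPolyA_zero, interPolyB, if_true, Bool.false_eq_true, if_false]
      field_simp
      ring
    · simp only [lastBProb, interPolyA_zero_right, interPolyB_zero_right, if_true,
        Bool.false_eq_true, if_false, Nat.succ_ne_zero]
      ring
  · intro a b
    simp only [lastBProb, interPolyB_succ, if_true, Bool.false_eq_true, if_false]
    generalize hDe : 1 - (1 - pa) * (1 - pb) = D at *
    rw [show a + (b + 1 + 1) = a + (b + 1) + 1 by ring]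
    field_simp
    ring

theorem stmt_3 (α β : ℕ) (hβ : 1 ≤ β) (pa pb : ℝ) (hpa0 : 0 < pa) (hpa1 : pa ≤ 1)
    (hpb0 : 0 ≤ pb) (hpb1 : pb ≤ 1) :
    soPr pa pb {g : List Bool | soScoreA g = α ∧ soScoreB g = β ∧ soLastB g} =
      pa ^ α * pb ^ β * (1 - pa) / (1 - (1 - pa) * (1 - pb)) ^ (α + β) *
        ∑ r ∈ Finset.Icc 1 (min α (β - 1) + 1),
          (α.choose (r - 1) : ℝ) * ((β - 1).choose (r - 1) : ℝ) *
            ((1 - pa) * (1 - pb)) ^ (r - 1) := by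
  obtain ⟨b, rfl⟩ : ∃ b, β = b + 1 := ⟨β - 1, by omega⟩
  have hq0 : 0 ≤ (1 - pa) * (1 - pb) := mul_nonneg (by linarith) (by linarith)
  have hq1 : (1 - pa) * (1 - pb) < 1 := by nlinarith
  have hpr : soPr pa pb {g | soScoreA g = α ∧ soScoreB g = b + 1 ∧ soLastB g} =
      ∑' g, lastBWeight pa pb true α b g := by
    refine tsum_congr fun g => ?_
    simp only [Set.indicator_apply, Set.mem_ofPred_eq, lastBWeight, soScoreA, soScoreB, soLastB]
  have hX0 (s : Bool) (a b : ℕ) : 0 ≤ lastBProb pa pb s a b := by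
    have hd : 0 ≤ 1 - (1 - pa) * (1 - pb) := by linarith
    refine mul_nonneg (by positivity) ?_
    split_ifs
    exacts [mul_nonneg (by linarith) (interPolyA_nonneg hq0 a b), interPolyB_nonneg hq0 a b]
  rw [hpr, tsum_lastBWeight hpa0.le hpa1 hpb0 hpb1 hq1.ne
    (firstRallyEquations_lastBProb hq1.ne) hX0, lastBProb, if_pos rfl, Nat.add_sub_cancel,
    ← interPolyA_eq_sum_Icc]
  ring
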